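/- Let ρ_min > 0, ρ_max > 0, and let z₀ ≤ z be real numbers with δz = z − z₀. If a real number ξ satisfies ρ_min·exp(−z₀)·(1 − δz + δz²/2) ≤ ξ and ξ ≤ ρ_max·exp(−z₀)·(1 − δz), then ξ also satisfies the exact bounds ρ_min·exp(−z) ≤ ξ ≤ ρ_max·exp(−z). -/

import Mathlib

/-- Conservativeness of the Taylor approximation of the exponential thrust bounds:
if `ρmin·exp(−z₀)·(1 − δz + δz²/2) ≤ ξ ≤ ρmax·exp(−z₀)·(1 − δz)` with `δz = z − z₀ ≥ 0`,
then `ρmin·exp(−z) ≤ ξ ≤ ρmax·exp(−z)`. -/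
theorem taylor_thrust_bounds_conservative (ρmin ρmax z₀ z ξ : ℝ)
    (hmin : 0 < ρmin) (hmax : 0 < ρmax) (hz : z₀ ≤ z)
    (hlb : ρmin * Real.exp (-z₀) * (1 - (z - z₀) + (z - z₀) ^ 2 / 2) ≤ ξ)
    (hub : ξ ≤ ρmax * Real.exp (-z₀) * (1 - (z - z₀))) :
    ρmin * Real.exp (-z) ≤ ξ ∧ ξ ≤ ρmax * Real.exp (-z) := by
  have hd : 0 ≤ z - z₀ := sub_nonneg.mpr hz
  have he : Real.exp (-z) = Real.exp (-z₀) * Real.exp (-(z - z₀)) := by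
    rw [← Real.exp_add]
    congr 1
    ring
  have hup : 1 - (z - z₀) ≤ Real.exp (-(z - z₀)) := Real.one_sub_le_exp_neg _
  have hlo : Real.exp (-(z - z₀)) ≤ 1 - (z - z₀) + (z - z₀) ^ 2 / 2 := by
    generalize z - z₀ = d at hd
    have hp := Real.quadratic_le_exp_of_nonneg hd
    have hppos : 0 < 1 + d + d ^ 2 / 2 := by positivity
    have h1 : Real.exp (-d) * Real.exp d = 1 := by
      rw [← Real.exp_add]
      simp
    have h2 : Real.exp (-d) * (1 + d + d ^ 2 / 2) ≤ 1 :=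
      (mul_le_mul_of_nonneg_left hp (Real.exp_pos _).le).trans h1.le
    have h3 : 1 ≤ (1 - d + d ^ 2 / 2) * (1 + d + d ^ 2 / 2) := by
      have h4 : 0 ≤ d ^ 4 := by positivity
      linarith [show (1 - d + d ^ 2 / 2) * (1 + d + d ^ 2 / 2) = 1 + d ^ 4 / 4 by ring]
    exact le_of_mul_le_mul_right (h2.trans h3) hppos
  rw [he, ← mul_assoc, ← mul_assoc]
  exact ⟨(mul_le_mul_of_nonneg_left hlo (by positivity)).trans hlb,
    hub.trans (mul_le_mul_of_nonneg_left hup (by positivity))⟩
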